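/- arXiv:1408.2454 — 5 statements merged into one kernel-verified Lean document; each statement's English description precedes it below -/
import Mathlib

section
/- Let T > 0, 0 < ε ≤ 1, 0 < λ₁ ≤ λ and 0 ≤ s ≤ t ≤ T. Then coshᵉ(√λ·t) ≤ ε^{−t/T}, sinhᵉ(√λ·t)/√λ ≤ ε^{−t/T}/√λ₁, and sinhᵉ(√λ·(t−s))/√λ ≤ ε^{(s−t)/T}/√λ₁. -/
/-- `Q(ε,λ) = e^{−√λ·T}/(ε + e^{−√λ·T})`. -/
noncomputable def regQ (T ε lam : ℝ) : ℝ :=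
  Real.exp (-(Real.sqrt lam * T)) / (ε + Real.exp (-(Real.sqrt lam * T)))

/-- `coshᵉ(√λ·t) = (Q(ε,λ)e^{√λ·t} + e^{−√λ·t})/2`. -/
noncomputable def coshE (T ε lam t : ℝ) : ℝ :=
  (regQ T ε lam * Real.exp (Real.sqrt lam * t) + Real.exp (-(Real.sqrt lam * t))) / 2

/-- `sinhᵉ(√λ·t) = (Q(ε,λ)e^{√λ·t} − e^{−√λ·t})/2`. -/
noncomputable def sinhE (T ε lam t : ℝ) : ℝ :=
  (regQ T ε lam * Real.exp (Real.sqrt lam * t) - Real.exp (-(Real.sqrt lam * t))) / 2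

theorem regQ_mul_exp_le (T ε lam t : ℝ) (hT : 0 < T) (hε0 : 0 < ε)
    (ht : 0 ≤ t) (htT : t ≤ T) :
    regQ T ε lam * Real.exp (Real.sqrt lam * t) ≤ ε ^ (-(t / T)) := by
  unfold regQ
  set a := Real.sqrt lam
  have hx : 0 < Real.exp (-(a * T)) := Real.exp_pos _
  have h0 : 0 ≤ t / T := by positivity
  have h1 : t / T ≤ 1 := (div_le_one hT).2 htT
  have key := Real.geom_mean_le_arith_mean2_weighted (sub_nonneg.2 h1) h0 hx.le hε0.le
    (by ring)
  have e1 : Real.exp (-(a * T)) ^ (1 - t / T) = Real.exp (-(a * T)) * Real.exp (a * t) := by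
    rw [← Real.exp_mul, ← Real.exp_add]
    congr 1
    field_simp
    ring
  rw [e1] at key
  have hp : 0 < ε ^ (t / T) := Real.rpow_pos_of_pos hε0 _
  rw [Real.rpow_neg hε0.le, div_mul_eq_mul_div, div_le_iff₀ (by positivity),
    inv_mul_eq_div, le_div_iff₀ hp]
  nlinarith [mul_nonneg h0 hx.le, mul_nonneg (sub_nonneg.2 h1) hε0.le]

theorem sinhE_div_le (T ε lam1 lam t : ℝ) (hT : 0 < T) (hε0 : 0 < ε)
    (hlam1 : 0 < lam1) (hlam : lam1 ≤ lam) (ht : 0 ≤ t) (htT : t ≤ T) :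
    sinhE T ε lam t / Real.sqrt lam ≤ ε ^ (-(t / T)) / Real.sqrt lam1 := by
  have h := regQ_mul_exp_le T ε lam t hT hε0 ht htT
  have hp : 0 < ε ^ (-(t / T)) := Real.rpow_pos_of_pos hε0 _
  have h2 := Real.exp_pos (-(Real.sqrt lam * t))
  have h3 : sinhE T ε lam t ≤ ε ^ (-(t / T)) := by
    unfold sinhE
    linarith
  exact div_le_div₀ hp.le h3 (Real.sqrt_pos.2 hlam1) (Real.sqrt_le_sqrt hlam)

theorem stmt_1 (T ε lam1 lam s t : ℝ) (hT : 0 < T) (hε0 : 0 < ε) (hε1 : ε ≤ 1)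
    (hlam1 : 0 < lam1) (hlam : lam1 ≤ lam) (hs : 0 ≤ s) (hst : s ≤ t) (htT : t ≤ T) :
    coshE T ε lam t ≤ ε ^ (-(t / T)) ∧
    sinhE T ε lam t / Real.sqrt lam ≤ ε ^ (-(t / T)) / Real.sqrt lam1 ∧
    sinhE T ε lam (t - s) / Real.sqrt lam ≤ ε ^ ((s - t) / T) / Real.sqrt lam1 := by
  have ht : 0 ≤ t := hs.trans hst
  refine ⟨?_, sinhE_div_le T ε lam1 lam t hT hε0 hlam1 hlam ht htT, ?_⟩
  · have h := regQ_mul_exp_le T ε lam t hT hε0 ht htT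
    have h1 : 1 ≤ ε ^ (-(t / T)) :=
      Real.one_le_rpow_of_pos_of_le_one_of_nonpos hε0 hε1 (neg_nonpos.2 (by positivity))
    have h2 : Real.exp (-(Real.sqrt lam * t)) ≤ 1 :=
      Real.exp_le_one_iff.2 (neg_nonpos.2 (by positivity))
    unfold coshE
    linarith
  · have h := sinhE_div_le T ε lam1 lam (t - s) hT hε0 hlam1 hlam (by linarith) (by linarith)
    have e : (s - t) / T = -((t - s) / T) := by ring
    rw [e]
    exact h
end

section
/- Let f : [0,T] × H → H be continuous and K-Lipschitz in its second variable, let 0 < ε ≤ 1, and let u¹, u² : [0,T] → H be continuous solutions of the regularized integral equation with source f, parameter ε, and data (φ¹, g¹) and (φ², g²) respectively. Then for every t ∈ [0,T]: ‖u¹(t) − u²(t)‖² ≤ 3·exp(3T²K²/λ₁)·ε^{−2t/T}·(‖φ¹ − φ²‖² + ‖g¹ − g²‖²/λ₁). -/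
open scoped RealInnerProductSpace

variable {H : Type*} [NormedAddCommGroup H] [InnerProductSpace ℝ H]

/-- `F` is `K`-Lipschitz in its second variable on `[0,T] × H`. -/
def LipschitzInSecond (T K : ℝ) (F : ℝ → H → H) : Prop :=
  ∀ t ∈ Set.Icc (0 : ℝ) T, ∀ w v : H, ‖F t w - F t v‖ ≤ K * ‖w - v‖

/-- `v` solves the regularized integral equation with source `F`, data `(φt, gt)`
and parameter `ε`. -/
def SolvesReg (T ε : ℝ) (lam : ℕ → ℝ) (b : HilbertBasis ℕ ℝ H)
    (F : ℝ → H → H) (φt gt : H) (v : ℝ → H) : Prop :=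
  ∀ t ∈ Set.Icc (0 : ℝ) T,
    v t = ∑' p : ℕ, (coshE T ε (lam p) t * ⟪φt, b p⟫
      + sinhE T ε (lam p) t / Real.sqrt (lam p) * ⟪gt, b p⟫
      + ∫ s in (0 : ℝ)..t,
          sinhE T ε (lam p) (t - s) / Real.sqrt (lam p) * ⟪F s (v s), b p⟫) • (b p : H)

/-- `u` solves the mild integral equation with source `F` and data `(φ, g)`. -/
def SolvesMild (T : ℝ) (lam : ℕ → ℝ) (b : HilbertBasis ℕ ℝ H)
    (F : ℝ → H → H) (φ g : H) (u : ℝ → H) : Prop :=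
  ∀ t ∈ Set.Icc (0 : ℝ) T,
    u t = ∑' p : ℕ, (Real.cosh (Real.sqrt (lam p) * t) * ⟪φ, b p⟫
      + Real.sinh (Real.sqrt (lam p) * t) / Real.sqrt (lam p) * ⟪g, b p⟫
      + ∫ s in (0 : ℝ)..t,
          Real.sinh (Real.sqrt (lam p) * (t - s)) / Real.sqrt (lam p)
            * ⟪F s (u s), b p⟫) • (b p : H)

/-- The pair `(u, w)` satisfies the exponential coefficient identity with source `F`
and data `(φ, g)`. -/
def ExpCoeffId (T : ℝ) (lam : ℕ → ℝ) (b : HilbertBasis ℕ ℝ H)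
    (F : ℝ → H → H) (φ g : H) (u w : ℝ → H) : Prop :=
  ∀ p : ℕ, ∀ t ∈ Set.Icc (0 : ℝ) T,
    ⟪u t, b p⟫ + ⟪w t, b p⟫ / Real.sqrt (lam p)
      = Real.exp (Real.sqrt (lam p) * t)
          * (⟪φ, b p⟫ + ⟪g, b p⟫ / Real.sqrt (lam p))
        + ∫ s in (0 : ℝ)..t,
            Real.exp (Real.sqrt (lam p) * (t - s)) / Real.sqrt (lam p)
              * ⟪F s (u s), b p⟫

/-- The pair `(u, w)` satisfies the a priori bound with constant `P`. -/
def APrioriBound (T : ℝ) (lam : ℕ → ℝ) (b : HilbertBasis ℕ ℝ H)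
    (u w : ℝ → H) (P : ℝ) : Prop :=
  ∀ t ∈ Set.Icc (0 : ℝ) T,
    ∑' p : ℕ, Real.exp (2 * Real.sqrt (lam p) * (T - t))
      * (⟪u t, b p⟫ + ⟪w t, b p⟫ / Real.sqrt (lam p)) ^ 2 ≤ P ^ 2

lemma aux_Q_bound (T ε lam t : ℝ) (hT : 0 < T) (hε0 : 0 < ε)
    (ht0 : 0 ≤ t) (htT : t ≤ T) :
    regQ T ε lam * Real.exp (Real.sqrt lam * t) ≤ ε ^ (-(t / T)) := by
  unfold regQ
  set r := Real.sqrt lam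
  set x := Real.exp (-(r * T)) with hx
  have hx0 : 0 < x := Real.exp_pos _
  have h1 : x * Real.exp (r * t) = x ^ (1 - t / T) := by
    rw [hx, ← Real.exp_add, ← Real.exp_mul]
    congr 1
    field_simp
    ring
  have htT' : t / T ≤ 1 := (div_le_one hT).2 htT
  have ht' : 0 ≤ t / T := div_nonneg ht0 hT.le
  calc x / (ε + x) * Real.exp (r * t) = x ^ (1 - t / T) / (ε + x) := by
        rw [← h1]; ring
    _ ≤ (ε + x) ^ (1 - t / T) / (ε + x) := by
        gcongr
        linarith
    _ = (ε + x) ^ (-(t / T)) := by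
        rw [sub_eq_add_neg, Real.rpow_add (by positivity), Real.rpow_one]
        field_simp
    _ ≤ ε ^ (-(t / T)) :=
        Real.rpow_le_rpow_of_nonpos hε0 (by linarith) (by linarith)

lemma aux_exp_bound (T ε lam t : ℝ) (hT : 0 < T) (hε0 : 0 < ε) (hε1 : ε ≤ 1)
    (ht0 : 0 ≤ t) :
    Real.exp (-(Real.sqrt lam * t)) ≤ ε ^ (-(t / T)) := by
  have h1 : Real.exp (-(Real.sqrt lam * t)) ≤ 1 := by
    rw [Real.exp_le_one_iff]
    have := mul_nonneg (Real.sqrt_nonneg lam) ht0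
    linarith
  refine h1.trans (Real.one_le_rpow_of_pos_of_le_one_of_nonpos hε0 hε1 ?_)
  have : 0 ≤ t / T := div_nonneg ht0 hT.le
  linarith

lemma aux_Q_nonneg (T ε lam : ℝ) (hε0 : 0 < ε) : 0 ≤ regQ T ε lam := by
  unfold regQ; positivity

lemma aux_cosh_sq (T ε lam t : ℝ) (hT : 0 < T) (hε0 : 0 < ε) (hε1 : ε ≤ 1)
    (ht0 : 0 ≤ t) (htT : t ≤ T) :
    coshE T ε lam t ^ 2 ≤ ε ^ (-(2 * t / T)) := by
  have h1 := aux_Q_bound T ε lam t hT hε0 ht0 htT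
  have h2 := aux_exp_bound T ε lam t hT hε0 hε1 ht0
  have h3 := mul_nonneg (aux_Q_nonneg T ε lam hε0) (Real.exp_pos (Real.sqrt lam * t)).le
  have h4 := (Real.exp_pos (-(Real.sqrt lam * t))).le
  have : ε ^ (-(2 * t / T)) = (ε ^ (-(t / T))) ^ 2 := by
    rw [← Real.rpow_natCast, ← Real.rpow_mul hε0.le]; congr 1; push_cast; ring
  rw [this]
  unfold coshE
  apply sq_le_sq'
  · linarith
  · linarith

lemma aux_sinh_sq (T ε lam t : ℝ) (hT : 0 < T) (hε0 : 0 < ε) (hε1 : ε ≤ 1)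
    (ht0 : 0 ≤ t) (htT : t ≤ T) :
    sinhE T ε lam t ^ 2 ≤ ε ^ (-(2 * t / T)) := by
  have h1 := aux_Q_bound T ε lam t hT hε0 ht0 htT
  have h2 := aux_exp_bound T ε lam t hT hε0 hε1 ht0
  have h3 := mul_nonneg (aux_Q_nonneg T ε lam hε0) (Real.exp_pos (Real.sqrt lam * t)).le
  have h4 := (Real.exp_pos (-(Real.sqrt lam * t))).le
  have : ε ^ (-(2 * t / T)) = (ε ^ (-(t / T))) ^ 2 := by
    rw [← Real.rpow_natCast, ← Real.rpow_mul hε0.le]; congr 1; push_cast; ring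
  rw [this]
  unfold sinhE
  apply sq_le_sq'
  · linarith
  · linarith

lemma aux_sinh_div_sq (T ε lam lam1 t : ℝ) (hT : 0 < T) (hε0 : 0 < ε) (hε1 : ε ≤ 1)
    (hlam1 : 0 < lam1) (hlam : lam1 ≤ lam) (ht0 : 0 ≤ t) (htT : t ≤ T) :
    (sinhE T ε lam t / Real.sqrt lam) ^ 2 ≤ ε ^ (-(2 * t / T)) / lam1 := by
  rw [div_pow, Real.sq_sqrt (by linarith)]
  have := aux_sinh_sq T ε lam t hT hε0 hε1 ht0 htT
  gcongr

lemma aux_sinh_cont (T ε lam : ℝ) : Continuous (sinhE T ε lam) := by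
  unfold sinhE; fun_prop

lemma aux_int_sq (h : ℝ → ℝ) (hh : Continuous h) (t : ℝ) (ht : 0 ≤ t) :
    (∫ s in (0 : ℝ)..t, h s) ^ 2 ≤ t * ∫ s in (0 : ℝ)..t, h s ^ 2 := by
  rcases ht.eq_or_lt with rfl | ht'
  · simp
  set I := ∫ s in (0 : ℝ)..t, h s with hI
  have h0 : 0 ≤ ∫ s in (0 : ℝ)..t, (t * h s - I) ^ 2 :=
    intervalIntegral.integral_nonneg ht fun _ _ => sq_nonneg _
  have h1 : ∫ s in (0 : ℝ)..t, (t * h s - I) ^ 2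
      = t ^ 2 * (∫ s in (0 : ℝ)..t, h s ^ 2) - 2 * t * I * I + t * I ^ 2 := by
    have : ∀ s, (t * h s - I) ^ 2 = (t ^ 2 * h s ^ 2 - 2 * t * I * h s) + I ^ 2 := by
      intro s; ring
    simp_rw [this]
    rw [intervalIntegral.integral_add, intervalIntegral.integral_sub,
      intervalIntegral.integral_const_mul, intervalIntegral.integral_const_mul,
      intervalIntegral.integral_const, ← hI]
    · simp
    all_goals exact Continuous.intervalIntegrable (by fun_prop) _ _
  rw [h1] at h0
  have h2 : 0 ≤ t * (t * (∫ s in (0 : ℝ)..t, h s ^ 2) - I ^ 2) := by nlinarith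
  have := nonneg_of_mul_nonneg_right h2 ht'
  linarith

lemma aux_bessel {H : Type*} [NormedAddCommGroup H] [InnerProductSpace ℝ H]
    (b : HilbertBasis ℕ ℝ H) (x : H) (S : Finset ℕ) :
    ∑ p ∈ S, ⟪x, b p⟫ ^ 2 ≤ ‖x‖ ^ 2 := by
  have := b.orthonormal.sum_inner_products_le (x := x) (s := S)
  simpa [real_inner_comm] using this

/-- Coefficients of the right-hand side of the regularized equation. -/
noncomputable def auxD {H : Type*} [NormedAddCommGroup H] [InnerProductSpace ℝ H]
    (T ε : ℝ) (lam : ℕ → ℝ) (b : HilbertBasis ℕ ℝ H) (φ g : H) (G : ℝ → H) (t : ℝ) (p : ℕ) : ℝ :=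
  coshE T ε (lam p) t * ⟪φ, b p⟫
      + sinhE T ε (lam p) t / Real.sqrt (lam p) * ⟪g, b p⟫
      + ∫ s in (0 : ℝ)..t,
          sinhE T ε (lam p) (t - s) / Real.sqrt (lam p) * ⟪G s, b p⟫

lemma auxD_bound {H : Type*} [NormedAddCommGroup H] [InnerProductSpace ℝ H]
    (T ε : ℝ) (hT : 0 < T) (hε0 : 0 < ε) (hε1 : ε ≤ 1)
    (lam : ℕ → ℝ) (lam1 : ℝ) (hlam1 : 0 < lam1) (hlam : ∀ p, lam1 ≤ lam p)
    (b : HilbertBasis ℕ ℝ H) (φ g : H) (G : ℝ → H) (hG : Continuous G) (t : ℝ)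
    (ht0 : 0 ≤ t) (htT : t ≤ T) (S : Finset ℕ) :
    ∑ p ∈ S, auxD T ε lam b φ g G t p ^ 2 ≤
      3 * (ε ^ (-(2 * t / T)) * ‖φ‖ ^ 2 + ε ^ (-(2 * t / T)) / lam1 * ‖g‖ ^ 2
        + t * ∫ s in (0 : ℝ)..t, ε ^ (-(2 * (t - s) / T)) / lam1 * ‖G s‖ ^ 2) := by
  have key : ∀ x y z : ℝ, (x + y + z) ^ 2 ≤ 3 * (x ^ 2 + y ^ 2 + z ^ 2) := by
    intro x y z
    nlinarith [sq_nonneg (x - y), sq_nonneg (y - z), sq_nonneg (x - z)]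
  have hE0 : 0 ≤ ε ^ (-(2 * t / T)) := Real.rpow_nonneg hε0.le _
  have hcont : ∀ p, Continuous fun s => sinhE T ε (lam p) (t - s) / Real.sqrt (lam p) * ⟪G s, b p⟫ := by
    intro p
    have := aux_sinh_cont T ε (lam p)
    fun_prop
  have hMc : Continuous fun s : ℝ => ε ^ (-(2 * (t - s) / T)) :=
    Continuous.rpow continuous_const (by fun_prop) fun _ => Or.inl hε0.ne'
  calc ∑ p ∈ S, auxD T ε lam b φ g G t p ^ 2
      ≤ ∑ p ∈ S, 3 * ((coshE T ε (lam p) t * ⟪φ, b p⟫) ^ 2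
          + (sinhE T ε (lam p) t / Real.sqrt (lam p) * ⟪g, b p⟫) ^ 2
          + (∫ s in (0 : ℝ)..t,
          sinhE T ε (lam p) (t - s) / Real.sqrt (lam p) * ⟪G s, b p⟫) ^ 2) :=
        Finset.sum_le_sum fun p _ => key _ _ _
    _ = 3 * (∑ p ∈ S, (coshE T ε (lam p) t * ⟪φ, b p⟫) ^ 2
          + ∑ p ∈ S, (sinhE T ε (lam p) t / Real.sqrt (lam p) * ⟪g, b p⟫) ^ 2
          + ∑ p ∈ S, (∫ s in (0 : ℝ)..t,
          sinhE T ε (lam p) (t - s) / Real.sqrt (lam p) * ⟪G s, b p⟫) ^ 2) := by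
        rw [← Finset.mul_sum, Finset.sum_add_distrib, Finset.sum_add_distrib]
    _ ≤ _ := by
        gcongr
        · calc _ ≤ ∑ p ∈ S, ε ^ (-(2 * t / T)) * ⟪φ, b p⟫ ^ 2 := by
                refine Finset.sum_le_sum fun p _ => ?_
                rw [mul_pow]
                exact mul_le_mul_of_nonneg_right
                  (aux_cosh_sq T ε (lam p) t hT hε0 hε1 ht0 htT) (sq_nonneg _)
            _ ≤ _ := by
                rw [← Finset.mul_sum]
                exact mul_le_mul_of_nonneg_left (aux_bessel b φ S) hE0
        · calc _ ≤ ∑ p ∈ S, ε ^ (-(2 * t / T)) / lam1 * ⟪g, b p⟫ ^ 2 := by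
                refine Finset.sum_le_sum fun p _ => ?_
                rw [mul_pow]
                exact mul_le_mul_of_nonneg_right
                  (aux_sinh_div_sq T ε (lam p) lam1 t hT hε0 hε1 hlam1 (hlam p) ht0 htT)
                  (sq_nonneg _)
            _ ≤ _ := by
                rw [← Finset.mul_sum]
                exact mul_le_mul_of_nonneg_left (aux_bessel b g S) (by positivity)
        · calc _ ≤ ∑ p ∈ S, t * ∫ s in (0 : ℝ)..t,
                (sinhE T ε (lam p) (t - s) / Real.sqrt (lam p) * ⟪G s, b p⟫) ^ 2 :=
                Finset.sum_le_sum fun p _ => aux_int_sq _ (hcont p) t ht0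
            _ = t * ∫ s in (0 : ℝ)..t, ∑ p ∈ S,
                (sinhE T ε (lam p) (t - s) / Real.sqrt (lam p) * ⟪G s, b p⟫) ^ 2 := by
                rw [← Finset.mul_sum, intervalIntegral.integral_finsetSum]
                intro p _
                exact ((hcont p).pow 2).intervalIntegrable _ _
            _ ≤ _ := by
                refine mul_le_mul_of_nonneg_left ?_ ht0
                refine intervalIntegral.integral_mono_on ht0 ?_ ?_ ?_
                · exact (continuous_finsetSum _ fun p _ => (hcont p).pow 2).intervalIntegrable _ _
                · exact Continuous.intervalIntegrable (by fun_prop) _ _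
                · intro s hs
                  have hs1 : 0 ≤ t - s := by linarith [hs.2]
                  have hs2 : t - s ≤ T := by linarith [hs.1]
                  calc _ ≤ ∑ p ∈ S, ε ^ (-(2 * (t - s) / T)) / lam1 * ⟪G s, b p⟫ ^ 2 := by
                        refine Finset.sum_le_sum fun p _ => ?_
                        rw [mul_pow]
                        exact mul_le_mul_of_nonneg_right
                          (aux_sinh_div_sq T ε (lam p) lam1 _ hT hε0 hε1 hlam1 (hlam p) hs1 hs2)
                          (sq_nonneg _)
                    _ ≤ _ := by
                        rw [← Finset.mul_sum]
                        exact mul_le_mul_of_nonneg_left (aux_bessel b _ S)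
                          (div_nonneg (Real.rpow_nonneg hε0.le _) hlam1.le)

lemma aux_coeff {H : Type*} [NormedAddCommGroup H] [InnerProductSpace ℝ H]
    (b : HilbertBasis ℕ ℝ H) (c : ℕ → ℝ) (M : ℝ)
    (hc : ∀ S : Finset ℕ, ∑ p ∈ S, c p ^ 2 ≤ M) (x : H) (hx : x = ∑' p, c p • b p) (p : ℕ) :
    ⟪x, b p⟫ = c p := by
  have hs : Summable fun p => c p ^ 2 :=
    summable_of_sum_le (fun _ => sq_nonneg _) hc
  have hm : Memℓp c 2 := by
    apply memℓp_gen
    simpa using hs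
  let C : lp (fun _ : ℕ => ℝ) 2 := ⟨c, hm⟩
  have h1 := (b.hasSum_repr_symm C).tsum_eq
  have h2 : x = b.repr.symm C := by rw [hx, ← h1]
  rw [real_inner_comm, ← b.repr_apply_apply, h2, LinearIsometryEquiv.apply_symm_apply]

lemma aux_norm_sq {H : Type*} [NormedAddCommGroup H] [InnerProductSpace ℝ H]
    (b : HilbertBasis ℕ ℝ H) (x : H) (M : ℝ)
    (hx : ∀ S : Finset ℕ, ∑ p ∈ S, ⟪x, b p⟫ ^ 2 ≤ M) : ‖x‖ ^ 2 ≤ M := by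
  have h := b.hasSum_inner_mul_inner x x
  rw [real_inner_self_eq_norm_sq] at h
  refine hasSum_le_of_sum_le h fun S => ?_
  refine le_trans (le_of_eq ?_) (hx S)
  refine Finset.sum_congr rfl fun p _ => ?_
  rw [real_inner_comm x (b p)]; ring

lemma aux_gronwall (h : ℝ → ℝ) (hh : Continuous h) (T a k : ℝ) (hk : 0 ≤ k)
    (hle : ∀ t ∈ Set.Icc (0 : ℝ) T, h t ≤ a + k * ∫ s in (0 : ℝ)..t, h s) :
    ∀ t ∈ Set.Icc (0 : ℝ) T, h t ≤ a * Real.exp (k * t) := by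
  intro t ht
  let W : ℝ → ℝ := fun t => Real.exp (-(k * t)) * (a + k * ∫ s in (0 : ℝ)..t, h s)
  have hd : ∀ x, HasDerivAt W (Real.exp (-(k * x)) * k *
      (h x - (a + k * ∫ s in (0 : ℝ)..x, h s))) x := by
    intro x
    have h1 : HasDerivAt (fun x => ∫ s in (0 : ℝ)..x, h s) (h x) x :=
      intervalIntegral.integral_hasDerivAt_right (hh.intervalIntegrable _ _)
        (hh.stronglyMeasurableAtFilter _ _) hh.continuousAt
    have h2 : HasDerivAt (fun x : ℝ => Real.exp (-(k * x))) (Real.exp (-(k * x)) * (-(k * 1))) x :=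
      (((hasDerivAt_id x).const_mul k).neg).exp
    have h3 := h2.mul ((h1.const_mul k).const_add a)
    refine h3.congr_deriv ?_
    ring
  have hW : AntitoneOn W (Set.Icc 0 T) := by
    refine antitoneOn_of_deriv_nonpos (convex_Icc _ _)
      (fun x _ => (hd x).continuousAt.continuousWithinAt)
      (fun x _ => (hd x).differentiableAt.differentiableWithinAt) fun x hx => ?_
    rw [(hd x).deriv]
    have hx' := hle x (interior_subset hx)
    exact mul_nonpos_of_nonneg_of_nonpos (mul_nonneg (Real.exp_pos _).le hk) (by linarith)
  have hW1 := hW ⟨le_rfl, ht.1.trans ht.2⟩ ht ht.1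
  have hW0 : W 0 = a := by simp [W]
  rw [hW0] at hW1
  have h4 := mul_le_mul_of_nonneg_right hW1 (Real.exp_pos (k * t)).le
  have h5 : W t * Real.exp (k * t) = a + k * ∫ s in (0 : ℝ)..t, h s := by
    simp only [W]
    rw [mul_right_comm, ← Real.exp_add]
    simp
  rw [h5] at h4
  exact (hle t ht).trans h4

theorem stmt_4 {H : Type*} [NormedAddCommGroup H] [InnerProductSpace ℝ H] [CompleteSpace H]
    (T K ε : ℝ) (hT : 0 < T) (hε0 : 0 < ε) (hε1 : ε ≤ 1)
    (lam : ℕ → ℝ) (lam1 : ℝ) (hlam1 : 0 < lam1) (hlam : ∀ p, lam1 ≤ lam p)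
    (b : HilbertBasis ℕ ℝ H) (f : ℝ → H → H)
    (hfc : ContinuousOn (Function.uncurry f) (Set.Icc (0 : ℝ) T ×ˢ (Set.univ : Set H)))
    (hfL : LipschitzInSecond T K f)
    (φ1 g1 φ2 g2 : H) (u1 u2 : ℝ → H)
    (hu1c : ContinuousOn u1 (Set.Icc 0 T)) (hu1 : SolvesReg T ε lam b f φ1 g1 u1)
    (hu2c : ContinuousOn u2 (Set.Icc 0 T)) (hu2 : SolvesReg T ε lam b f φ2 g2 u2) :
    ∀ t ∈ Set.Icc (0 : ℝ) T,
      ‖u1 t - u2 t‖ ^ 2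
        ≤ 3 * Real.exp (3 * T ^ 2 * K ^ 2 / lam1) * ε ^ (-(2 * t / T))
          * (‖φ1 - φ2‖ ^ 2 + ‖g1 - g2‖ ^ 2 / lam1) := by
  have hTle : (0 : ℝ) ≤ T := hT.le
  -- continuous extension by projection
  let π : ℝ → ℝ := fun s => (Set.projIcc 0 T hTle s : ℝ)
  have hπc : Continuous π := continuous_subtype_val.comp continuous_projIcc
  have hπm : ∀ s, π s ∈ Set.Icc (0 : ℝ) T := fun s => (Set.projIcc 0 T hTle s).2
  have hπe : ∀ s ∈ Set.Icc (0 : ℝ) T, π s = s := fun s hs => by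
    simp only [π]; rw [Set.projIcc_of_mem hTle hs]
  have hv1 : Continuous fun s => u1 (π s) := hu1c.comp_continuous hπc hπm
  have hv2 : Continuous fun s => u2 (π s) := hu2c.comp_continuous hπc hπm
  have hG1 : Continuous fun s => f (π s) (u1 (π s)) :=
    hfc.comp_continuous (hπc.prodMk hv1) fun s => ⟨hπm s, Set.mem_univ _⟩
  have hG2 : Continuous fun s => f (π s) (u2 (π s)) :=
    hfc.comp_continuous (hπc.prodMk hv2) fun s => ⟨hπm s, Set.mem_univ _⟩
  -- coefficients
  have coeff : ∀ (φ g : H) (u : ℝ → H), (Continuous fun s => f (π s) (u (π s))) →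
      SolvesReg T ε lam b f φ g u → ∀ t ∈ Set.Icc (0 : ℝ) T, ∀ p,
      ⟪u t, b p⟫ = auxD T ε lam b φ g (fun s => f (π s) (u (π s))) t p := by
    intro φ g u hG hu t ht p
    refine aux_coeff b _ _
      (auxD_bound T ε hT hε0 hε1 lam lam1 hlam1 hlam b φ g _ hG t ht.1 ht.2) _ ?_ p
    rw [hu t ht]
    refine tsum_congr fun q => ?_
    unfold auxD
    congr 2
    refine intervalIntegral.integral_congr fun s hs => ?_
    rw [Set.uIcc_of_le ht.1] at hs
    simp only [hπe s ⟨hs.1, hs.2.trans ht.2⟩]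
  have hdiff : ∀ t ∈ Set.Icc (0 : ℝ) T, ∀ p, ⟪u1 t - u2 t, b p⟫ =
      auxD T ε lam b (φ1 - φ2) (g1 - g2)
        (fun s => f (π s) (u1 (π s)) - f (π s) (u2 (π s))) t p := by
    intro t ht p
    have hsc := aux_sinh_cont T ε (lam p)
    rw [inner_sub_left, coeff φ1 g1 u1 hG1 hu1 t ht p, coeff φ2 g2 u2 hG2 hu2 t ht p]
    unfold auxD
    simp only [inner_sub_left, mul_sub]
    rw [intervalIntegral.integral_sub]
    · ring
    · exact Continuous.intervalIntegrable (((hsc.comp (continuous_const.sub continuous_id)).div_const _).mul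
        (hG1.inner continuous_const)) _ _
    · exact Continuous.intervalIntegrable (((hsc.comp (continuous_const.sub continuous_id)).div_const _).mul
        (hG2.inner continuous_const)) _ _
  let A : ℝ := ‖φ1 - φ2‖ ^ 2 + ‖g1 - g2‖ ^ 2 / lam1
  have hA : 0 ≤ A := by positivity
  let h : ℝ → ℝ := fun s => ε ^ (2 * s / T) * ‖u1 (π s) - u2 (π s)‖ ^ 2
  have hEc : Continuous fun s : ℝ => ε ^ (2 * s / T) :=
    Continuous.rpow continuous_const (by fun_prop) fun _ => Or.inl hε0.ne'
  have hhc : Continuous h := by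
    exact hEc.mul ((hv1.sub hv2).norm.pow 2)
  have hh0 : ∀ s, 0 ≤ h s := fun s => mul_nonneg (Real.rpow_nonneg hε0.le _) (sq_nonneg _)
  have hmain : ∀ t ∈ Set.Icc (0 : ℝ) T,
      h t ≤ 3 * A + (3 * T * K ^ 2 / lam1) * ∫ s in (0 : ℝ)..t, h s := by
    intro t ht
    have hb := aux_norm_sq b (u1 t - u2 t) _ fun S => by
      simp only [hdiff t ht]
      exact auxD_bound T ε hT hε0 hε1 lam lam1 hlam1 hlam b (φ1 - φ2) (g1 - g2) _
        (hG1.sub hG2) t ht.1 ht.2 S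
    simp only [Pi.sub_apply] at hb
    have hI0 : 0 ≤ ∫ s in (0 : ℝ)..t, h s :=
      intervalIntegral.integral_nonneg ht.1 fun s _ => hh0 s
    have hMc : Continuous fun s : ℝ => ε ^ (-(2 * (t - s) / T)) :=
      Continuous.rpow continuous_const (by fun_prop) fun _ => Or.inl hε0.ne'
    have hint : (∫ s in (0 : ℝ)..t, ε ^ (-(2 * (t - s) / T)) / lam1 *
        ‖f (π s) (u1 (π s)) - f (π s) (u2 (π s))‖ ^ 2)
        ≤ ε ^ (-(2 * t / T)) * (K ^ 2 / lam1) * ∫ s in (0 : ℝ)..t, h s := by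
      rw [← intervalIntegral.integral_const_mul]
      refine intervalIntegral.integral_mono_on ht.1 ?_ ?_ fun s hs => ?_
      · exact Continuous.intervalIntegrable
          ((hMc.div_const _).mul ((hG1.sub hG2).norm.pow 2)) _ _
      · exact Continuous.intervalIntegrable (hhc.const_mul _) _ _
      · have hL := hfL (π s) (hπm s) (u1 (π s)) (u2 (π s))
        have hL2 : ‖f (π s) (u1 (π s)) - f (π s) (u2 (π s))‖ ^ 2
            ≤ K ^ 2 * ‖u1 (π s) - u2 (π s)‖ ^ 2 := by
          rw [← mul_pow]
          exact pow_le_pow_left₀ (norm_nonneg _) hL 2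
        have hexp : ε ^ (-(2 * (t - s) / T)) = ε ^ (-(2 * t / T)) * ε ^ (2 * s / T) := by
          rw [← Real.rpow_add hε0]; congr 1; ring
        calc _ ≤ ε ^ (-(2 * (t - s) / T)) / lam1 * (K ^ 2 * ‖u1 (π s) - u2 (π s)‖ ^ 2) :=
              mul_le_mul_of_nonneg_left hL2
                (div_nonneg (Real.rpow_nonneg hε0.le _) hlam1.le)
          _ = _ := by rw [hexp]; simp only [h]; ring
    have hE1 : ε ^ (2 * t / T) * ε ^ (-(2 * t / T)) = 1 := by
      rw [← Real.rpow_add hε0]; simp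
    have hE0 : 0 ≤ ε ^ (2 * t / T) := Real.rpow_nonneg hε0.le _
    have h2 := mul_le_mul_of_nonneg_left hint ht.1
    calc h t = ε ^ (2 * t / T) * ‖u1 t - u2 t‖ ^ 2 := by simp only [h, hπe t ht]
      _ ≤ ε ^ (2 * t / T) * (3 * (ε ^ (-(2 * t / T)) * ‖φ1 - φ2‖ ^ 2
          + ε ^ (-(2 * t / T)) / lam1 * ‖g1 - g2‖ ^ 2
          + t * (ε ^ (-(2 * t / T)) * (K ^ 2 / lam1) * ∫ s in (0 : ℝ)..t, h s))) := by
          refine mul_le_mul_of_nonneg_left (hb.trans ?_) hE0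
          linarith
      _ = (ε ^ (2 * t / T) * ε ^ (-(2 * t / T))) *
          (3 * A + (3 * t * K ^ 2 / lam1) * ∫ s in (0 : ℝ)..t, h s) := by
          simp only [A]; ring
      _ ≤ _ := by
          rw [hE1, one_mul]
          have := ht.2
          gcongr
  intro t ht
  have hg := aux_gronwall h hhc T (3 * A) (3 * T * K ^ 2 / lam1) (by positivity) hmain t ht
  have hE1 : ε ^ (-(2 * t / T)) * ε ^ (2 * t / T) = 1 := by
    rw [← Real.rpow_add hε0]; simp
  have hE0 : 0 ≤ ε ^ (-(2 * t / T)) := Real.rpow_nonneg hε0.le _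
  have hexp : Real.exp (3 * T * K ^ 2 / lam1 * t) ≤ Real.exp (3 * T ^ 2 * K ^ 2 / lam1) := by
    apply Real.exp_le_exp.2
    calc 3 * T * K ^ 2 / lam1 * t ≤ 3 * T * K ^ 2 / lam1 * T :=
          mul_le_mul_of_nonneg_left ht.2 (by positivity)
      _ = _ := by ring
  calc ‖u1 t - u2 t‖ ^ 2 = ε ^ (-(2 * t / T)) * h t := by
        simp only [h, hπe t ht]
        rw [← mul_assoc, hE1, one_mul]
    _ ≤ ε ^ (-(2 * t / T)) * (3 * A * Real.exp (3 * T ^ 2 * K ^ 2 / lam1)) := by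
        refine mul_le_mul_of_nonneg_left (hg.trans ?_) hE0
        exact mul_le_mul_of_nonneg_left hexp (by positivity)
    _ = _ := by simp only [A]; ring
end

section
/- Let T > 0 and 0 < ε < min(1, T). Then there exists a unique t_ε ∈ (0,T) such that (T − t_ε)² = ε^{2 − 2t_ε/T}, and this t_ε satisfies T − t_ε < √(T/ln(1/ε)). -/
theorem aux_iff (T ε t : ℝ) (hT : 0 < T) (hε0 : 0 < ε) (ht : t < T) :
    (T - t) ^ 2 = ε ^ (2 - 2 * t / T) ↔
      (T - t) * Real.exp ((T - t) * (Real.log (1 / ε) / T)) = 1 := by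
  have e1 : ε ^ (2 - 2 * t / T) = (Real.exp (-((T - t) * (Real.log (1 / ε) / T)))) ^ 2 := by
    rw [Real.rpow_def_of_pos hε0, ← Real.exp_nat_mul]
    congr 1
    rw [one_div, Real.log_inv]
    push_cast
    field_simp
  rw [e1, pow_left_inj₀ (by linarith) (Real.exp_pos _).le (by norm_num), Real.exp_neg,
    ← one_div, eq_div_iff (Real.exp_pos _).ne']

theorem stmt_8 (T ε : ℝ) (hT : 0 < T) (hε0 : 0 < ε) (hε1 : ε < min 1 T) :
    (∃! t : ℝ, t ∈ Set.Ioo (0 : ℝ) T ∧ (T - t) ^ 2 = ε ^ (2 - 2 * t / T)) ∧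
    (∀ t ∈ Set.Ioo (0 : ℝ) T, (T - t) ^ 2 = ε ^ (2 - 2 * t / T) →
      T - t < Real.sqrt (T / Real.log (1 / ε))) := by
  obtain ⟨h1, h2⟩ := lt_min_iff.1 hε1
  have hL : 0 < Real.log (1 / ε) := Real.log_pos (by rw [lt_div_iff₀ hε0]; linarith)
  have key := fun t (ht : t < T) => aux_iff T ε t hT hε0 ht
  have hexp : Real.exp (Real.log (1 / ε)) = 1 / ε := Real.exp_log (by positivity)
  generalize hLd : Real.log (1 / ε) = L at *
  have hc : 0 < L / T := div_pos hL hT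
  have anti : ∀ a b : ℝ, a < b → b < T →
      (T - b) * Real.exp ((T - b) * (L / T)) < (T - a) * Real.exp ((T - a) * (L / T)) := by
    intro a b hab hb
    have h3 : T - b < T - a := by linarith
    have h4 : 0 < T - b := by linarith
    have h5 : Real.exp ((T - b) * (L / T)) < Real.exp ((T - a) * (L / T)) :=
      Real.exp_lt_exp.2 (mul_lt_mul_of_pos_right h3 hc)
    exact mul_lt_mul h3 h5.le (Real.exp_pos _) (by linarith)
  refine ⟨?_, ?_⟩
  · have hcont : ContinuousOn (fun t => (T - t) * Real.exp ((T - t) * (L / T))) (Set.Icc 0 T) := by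
      fun_prop
    have hmem : (1 : ℝ) ∈ Set.Ioo ((fun t => (T - t) * Real.exp ((T - t) * (L / T))) T)
        ((fun t => (T - t) * Real.exp ((T - t) * (L / T))) 0) := by
      constructor
      · simp
      · have : (T - 0) * (L / T) = L := by field_simp; ring
        simp only [this, hexp]
        rw [mul_one_div, lt_div_iff₀ hε0]
        linarith
    obtain ⟨t, ht, hte⟩ := intermediate_value_Ioo' hT.le hcont hmem
    refine ⟨t, ⟨ht, (key t ht.2).2 hte⟩, ?_⟩
    rintro u ⟨hu, hue⟩
    have hue' := (key u hu.2).1 hue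
    simp only at hte
    rcases lt_trichotomy u t with h | h | h
    · have := anti u t h ht.2
      linarith
    · exact h
    · have := anti t u h hu.2
      linarith
  · intro t ht he
    have h3 := (key t ht.2).1 he
    have h4 : 0 < T - t := by linarith [ht.2]
    have h5 := Real.add_one_le_exp ((T - t) * (L / T))
    have h6 := mul_le_mul_of_nonneg_left h5 h4.le
    apply Real.lt_sqrt_of_sq_lt
    have h7 : (T - t) ^ 2 * (L / T) < 1 := by nlinarith
    rw [lt_div_iff₀ hL]
    rw [← mul_div_assoc, div_lt_one hT] at h7
    exact h7
end

section
/- Let s > 0, T > 0, X ≥ 0 and 0 < ε < 1. Then ε/((1+X)^s·(ε + e^{−TX})) ≤ C(s)·(T/ln(1/ε))^s, where C(s) = s^s·e^{1−s}·(1 + T^{−s}). -/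
theorem aux_pow (s u : ℝ) (hs : 0 < s) (hu : 0 < u) :
    u ^ s ≤ s ^ s * Real.exp (u - s) := by
  have h1 : u / s ≤ Real.exp (u / s - 1) := by
    have := Real.add_one_le_exp (u / s - 1)
    linarith
  have h2 : u ≤ s * Real.exp (u / s - 1) := by
    rw [div_le_iff₀ hs] at h1
    linarith
  calc u ^ s ≤ (s * Real.exp (u / s - 1)) ^ s := Real.rpow_le_rpow hu.le h2 hs.le
    _ = s ^ s * Real.exp (u - s) := by
      rw [Real.mul_rpow hs.le (Real.exp_pos _).le, ← Real.exp_mul]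
      congr 2
      field_simp

theorem stmt_11 (s T X ε : ℝ) (hs : 0 < s) (hT : 0 < T) (hX : 0 ≤ X)
    (hε0 : 0 < ε) (hε1 : ε < 1) :
    ε / ((1 + X) ^ s * (ε + Real.exp (-(T * X))))
      ≤ (s ^ s * Real.exp (1 - s) * (1 + T ^ (-s))) * (T / Real.log (1 / ε)) ^ s := by
  have hL : 0 < Real.log (1 / ε) := Real.log_pos (by rw [lt_div_iff₀ hε0]; linarith)
  have hεL : ε = Real.exp (-Real.log (1 / ε)) := by
    rw [one_div, Real.log_inv, neg_neg, Real.exp_log hε0]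
  generalize Real.log (1 / ε) = L at hL hεL
  have hTs : 0 < T ^ s := Real.rpow_pos_of_pos hT s
  have hLs : 0 < L ^ s := Real.rpow_pos_of_pos hL s
  have hXs : 0 < (1 + X) ^ s := Real.rpow_pos_of_pos (by linarith) s
  have hss : 0 < s ^ s := Real.rpow_pos_of_pos hs s
  have hC : 1 ≤ s ^ s * Real.exp (1 - s) := by
    simpa using aux_pow s 1 hs one_pos
  have hE : Real.exp (-(T * X)) = ε * Real.exp (L - T * X) := by
    rw [hεL, ← Real.exp_add]; congr 1; ring
  have hEp := Real.exp_pos (L - T * X)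
  have key : L ^ s ≤ s ^ s * Real.exp (1 - s) * (T ^ s + 1) *
      ((1 + X) ^ s * (1 + Real.exp (L - T * X))) := by
    suffices h : L ^ s ≤ (s ^ s * Real.exp (1 - s) * (T ^ s + 1) *
        (1 + Real.exp (L - T * X))) * (1 + X) ^ s by linarith
    rcases le_total (L - T * X) T with h | h
    · have h1 : L ^ s ≤ T ^ s * (1 + X) ^ s := by
        rw [← Real.mul_rpow hT.le (by linarith)]
        exact Real.rpow_le_rpow hL.le (by linarith) hs.le
      refine h1.trans (mul_le_mul_of_nonneg_right ?_ hXs.le)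
      calc T ^ s = 1 * T ^ s * 1 := by ring
        _ ≤ _ := by gcongr <;> linarith
    · have hu : 0 < L - T * X := by linarith
      have h1 : L ^ s ≤ (L - T * X) ^ s * (1 + X) ^ s := by
        rw [← Real.mul_rpow hu.le (by linarith)]
        exact Real.rpow_le_rpow hL.le (by nlinarith) hs.le
      refine h1.trans (mul_le_mul_of_nonneg_right ?_ hXs.le)
      calc (L - T * X) ^ s ≤ s ^ s * Real.exp (L - T * X - s) := aux_pow s _ hs hu
        _ = s ^ s * Real.exp (-s) * 1 * Real.exp (L - T * X) := by
          rw [sub_eq_add_neg (L - T * X), Real.exp_add]; ring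
        _ ≤ _ := by gcongr <;> linarith
  have hR : (s ^ s * Real.exp (1 - s) * (1 + T ^ (-s))) * (T / L) ^ s
      = s ^ s * Real.exp (1 - s) * (T ^ s + 1) / L ^ s := by
    rw [Real.div_rpow hT.le hL.le, Real.rpow_neg hT.le]
    field_simp
  have hLhs : ε / ((1 + X) ^ s * (ε + Real.exp (-(T * X))))
      = 1 / ((1 + X) ^ s * (1 + Real.exp (L - T * X))) := by
    rw [hE]
    field_simp
  rw [hR, hLhs, div_le_div_iff₀ (by positivity) hLs]
  linarith
end

section
/- Let T > 0, s > 0, 0 < ε < 1, let (λ_p)_{p∈ℕ} be a sequence of positive real numbers, and let (c_p)_{p∈ℕ} be a sequence of real numbers such that Σ_p (1 + √λ_p)^{2s}·c_p² converges. Then Σ_p (ε/(ε + e^{−√λ_p·T}))²·c_p² ≤ C(s)²·(T/ln(1/ε))^{2s}·Σ_p (1 + √λ_p)^{2s}·c_p², where C(s) = s^s·e^{1−s}·(1 + T^{−s}). -/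
lemma aux_key (s r : ℝ) (hs : 0 < s) (hr : 0 < r) :
    r ^ s * Real.exp (1 - r) ≤ s ^ s * Real.exp (1 - s) := by
  rw [Real.rpow_def_of_pos hr, Real.rpow_def_of_pos hs, ← Real.exp_add, ← Real.exp_add]
  apply Real.exp_le_exp.mpr
  have h := Real.log_le_sub_one_of_pos (div_pos hr hs)
  rw [Real.log_div hr.ne' hs.ne'] at h
  have h2 := mul_le_mul_of_nonneg_left h hs.le
  have h3 : s * (r / s - 1) = r - s := by field_simp
  rw [h3] at h2
  nlinarith

lemma aux_pt (T s L x : ℝ) (hT : 0 < T) (hs : 0 < s) (hL : 0 < L) (hx : 0 ≤ x) :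
    Real.exp (-L) / (Real.exp (-L) + Real.exp (-(x * T))) ≤
      (s ^ s * Real.exp (1 - s) * (1 + T ^ (-s))) * (T / L) ^ s * (1 + x) ^ s := by
  set q := Real.exp (-L) / (Real.exp (-L) + Real.exp (-(x * T))) with hq
  set K := s ^ s * Real.exp (1 - s) with hK
  have hK1 : 1 ≤ K := by
    have := aux_key s 1 hs one_pos
    simpa using this
  have hq1 : q ≤ 1 := by
    rw [hq, div_le_one (by positivity)]
    linarith [Real.exp_pos (-(x * T))]
  set z := max 1 (x * T) with hz
  have hz1 : 1 ≤ z := le_max_left _ _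
  have hzy : x * T ≤ z := le_max_right _ _
  have hz0 : 0 < z := by linarith
  have hqe : q ≤ Real.exp (z - L) := by
    have h1 : q ≤ Real.exp (-L) / Real.exp (-(x * T)) := by
      rw [hq]
      gcongr
      linarith [Real.exp_pos (-L)]
    rw [← Real.exp_sub] at h1
    exact h1.trans (Real.exp_le_exp.mpr (by linarith))
  have hmain : q ≤ K * (z / L) ^ s := by
    have hLz : 0 < (L / z) ^ s := by positivity
    have hinv : (z / L) ^ s = ((L / z) ^ s)⁻¹ := by
      rw [← Real.inv_rpow (by positivity), inv_div]
    rw [hinv, ← div_eq_mul_inv, le_div_iff₀ hLz]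
    rcases le_total L z with h | h
    · have h1 : (L / z) ^ s ≤ 1 :=
        Real.rpow_le_one (by positivity) ((div_le_one hz0).mpr h) hs.le
      nlinarith
    · have h1 := aux_key s (L / z) hs (by positivity)
      have h2 : z - L ≤ 1 - L / z := by
        have hr : 1 ≤ L / z := (one_le_div hz0).mpr h
        have : L = z * (L / z) := by field_simp
        nlinarith
      calc q * (L / z) ^ s ≤ Real.exp (1 - L / z) * (L / z) ^ s := by
            gcongr
            exact hqe.trans (Real.exp_le_exp.mpr h2)
        _ ≤ K := by rw [mul_comm]; exact h1
  have hM : z ^ s ≤ (1 + T ^ (-s)) * T ^ s * (1 + x) ^ s := by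
    have e : (1 + T ^ (-s)) * T ^ s = T ^ s + 1 := by
      rw [add_mul, ← Real.rpow_add hT]; simp
    rw [e]
    have hp : 0 < T ^ s := by positivity
    have h1 : 1 ≤ (1 + x) ^ s := Real.one_le_rpow (by linarith) hs.le
    rcases le_total 1 (x * T) with h | h
    · rw [hz, max_eq_right h]
      have : (x * T) ^ s ≤ (1 + x) ^ s * T ^ s := by
        rw [← Real.mul_rpow (by linarith) hT.le]
        gcongr
        linarith
      nlinarith
    · rw [hz, max_eq_left h, Real.one_rpow]
      nlinarith
  refine hmain.trans ?_
  rw [Real.div_rpow hz0.le hL.le, Real.div_rpow hT.le hL.le]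
  have hLs : 0 < L ^ s := by positivity
  calc K * (z ^ s / L ^ s) ≤ K * (((1 + T ^ (-s)) * T ^ s * (1 + x) ^ s) / L ^ s) := by
        gcongr
    _ = _ := by ring

theorem stmt_18 (T s ε : ℝ) (hT : 0 < T) (hs : 0 < s) (hε0 : 0 < ε) (hε1 : ε < 1)
    (lam : ℕ → ℝ) (hlam : ∀ p, 0 < lam p) (c : ℕ → ℝ)
    (hsum : Summable fun p => (1 + Real.sqrt (lam p)) ^ (2 * s) * c p ^ 2) :
    ∑' p : ℕ, (ε / (ε + Real.exp (-(Real.sqrt (lam p) * T)))) ^ 2 * c p ^ 2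
      ≤ (s ^ s * Real.exp (1 - s) * (1 + T ^ (-s))) ^ 2 * (T / Real.log (1 / ε)) ^ (2 * s)
        * ∑' p : ℕ, (1 + Real.sqrt (lam p)) ^ (2 * s) * c p ^ 2 := by
  have hL : 0 < Real.log (1 / ε) := Real.log_pos ((one_lt_div hε0).mpr hε1)
  have hεL : Real.exp (-Real.log (1 / ε)) = ε := by
    rw [one_div, Real.log_inv, neg_neg, Real.exp_log hε0]
  have hpow : ∀ a : ℝ, 0 ≤ a → a ^ (2 * s) = (a ^ s) ^ 2 := by
    intro a ha
    rw [mul_comm, Real.rpow_mul ha]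
    exact Real.rpow_natCast _ 2
  have hpt : ∀ p, (ε / (ε + Real.exp (-(Real.sqrt (lam p) * T)))) ^ 2 * c p ^ 2 ≤
      (s ^ s * Real.exp (1 - s) * (1 + T ^ (-s))) ^ 2 * (T / Real.log (1 / ε)) ^ (2 * s)
        * ((1 + Real.sqrt (lam p)) ^ (2 * s) * c p ^ 2) := by
    intro p
    have h := aux_pt T s _ (Real.sqrt (lam p)) hT hs hL (Real.sqrt_nonneg _)
    rw [hεL] at h
    have h2 := pow_le_pow_left₀ (by positivity) h 2
    rw [hpow _ (by positivity), hpow _ (by positivity)]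
    refine (mul_le_mul_of_nonneg_right h2 (sq_nonneg (c p))).trans (le_of_eq ?_)
    ring
  rw [← tsum_mul_left]
  have hs2 := hsum.mul_left ((s ^ s * Real.exp (1 - s) * (1 + T ^ (-s))) ^ 2 *
    (T / Real.log (1 / ε)) ^ (2 * s))
  exact Summable.tsum_le_tsum hpt
    (Summable.of_nonneg_of_le (fun p => by positivity) hpt hs2) hs2
end
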